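/- Let (Γ; ≤₁, …, ≤ₙ) be a homogeneous n-dimensional permutation structure, E a ∅-definable equivalence relation on Γ, and C₁, C₂ two E-classes. Then C₁ remains homogeneous after naming C₂: every isomorphism between finite substructures of Γ contained in C₁ (i.e., every bijection between finite subsets of C₁ preserving each ≤ᵢ) extends to an automorphism σ of Γ with σ(C₁) = C₁ and σ(C₂) = C₂. -/

import Mathlib

/-- An `n`-dimensional permutation structure: a set `Γ` equipped with `n` linear orders. -/
structure PermStruct (n : ℕ) (Γ : Type*) where
  le : Fin n → Γ → Γ → Prop
  total : ∀ i x y, le i x y ∨ le i y x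
  antisymm : ∀ i x y, le i x y → le i y x → x = y
  trans : ∀ i x y z, le i x y → le i y z → le i x z

namespace PermStruct

variable {n : ℕ} {Γ : Type*} (S : PermStruct n Γ)

/-- An automorphism of the permutation structure: a bijection of `Γ` preserving each order. -/
def IsAuto (σ : Γ ≃ Γ) : Prop :=
  ∀ i x y, S.le i x y ↔ S.le i (σ x) (σ y)

/-- Homogeneity: every isomorphism between finite substructures (i.e. every bijection between
finite subsets preserving each order) extends to an automorphism. -/
def Homogeneous : Prop :=
  ∀ (A : Finset Γ) (f : Γ → Γ), Set.InjOn f A →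
    (∀ i, ∀ x ∈ A, ∀ y ∈ A, (S.le i x y ↔ S.le i (f x) (f y))) →
    ∃ σ : Γ ≃ Γ, S.IsAuto σ ∧ ∀ a ∈ A, σ a = f a

/-- A binary relation is ∅-definable iff it is invariant under all automorphisms. -/
def Definable (R : Γ → Γ → Prop) : Prop :=
  ∀ σ : Γ ≃ Γ, S.IsAuto σ → ∀ x y, R x y ↔ R (σ x) (σ y)

/-- `E` is `≤ᵢ`-convex: every `E`-class is an interval with respect to `≤ᵢ`. -/
def Convex (i : Fin n) (E : Γ → Γ → Prop) : Prop :=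
  ∀ x y z, S.le i x y → S.le i y z → E x z → E x y

end PermStruct

namespace PermStruct

variable {n : ℕ} {Γ : Type*} {S : PermStruct n Γ} {E : Γ → Γ → Prop}

lemma le_self (S : PermStruct n Γ) (i : Fin n) (x : Γ) : S.le i x x := by
  simpa using S.total i x x

/-- The strict part of the `i`-th order. -/
def lt (S : PermStruct n Γ) (i : Fin n) (x y : Γ) : Prop := ¬ S.le i y x

/-- `x` lies strictly below `y` in every order. -/
def AllLt (S : PermStruct n Γ) (x y : Γ) : Prop := ∀ i, S.lt i x y

/-- The `i`-th order as a bundled linear order. -/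
noncomputable abbrev lin (S : PermStruct n Γ) (i : Fin n) : LinearOrder Γ where
  le := S.le i
  le_refl := S.le_self i
  le_trans := S.trans i
  le_antisymm := S.antisymm i
  le_total := S.total i
  toDecidableLE := Classical.decRel _

lemma lt.le {i : Fin n} {x y : Γ} (h : S.lt i x y) : S.le i x y :=
  (S.total i x y).resolve_right h

lemma lt.trans {i : Fin n} {x y z : Γ} (h : S.lt i x y) (h' : S.lt i y z) : S.lt i x z :=
  fun hzx => h (S.trans i _ _ _ h'.le hzx)

lemma lt_of_lt_of_le {i : Fin n} {x y z : Γ} (h : S.lt i x y) (h' : S.le i y z) : S.lt i x z :=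
  fun hzx => h (S.trans i _ _ _ h' hzx)

lemma lt_of_le_of_lt {i : Fin n} {x y z : Γ} (h : S.le i x y) (h' : S.lt i y z) : S.lt i x z :=
  fun hzx => h' (S.trans i _ _ _ hzx h)

lemma lt.ne {i : Fin n} {x y : Γ} (h : S.lt i x y) : x ≠ y := by
  rintro rfl
  exact h (S.le_self i x)

lemma lt_of_le_of_ne {i : Fin n} {x y : Γ} (h : S.le i x y) (h' : x ≠ y) : S.lt i x y :=
  fun hyx => h' (S.antisymm i _ _ h hyx)

lemma lt_or_lt_of_ne (i : Fin n) {x y : Γ} (h : x ≠ y) : S.lt i x y ∨ S.lt i y x :=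
  (S.total i x y).imp (lt_of_le_of_ne · h) (lt_of_le_of_ne · h.symm)

lemma AllLt.trans {x y z : Γ} (h : S.AllLt x y) (h' : S.AllLt y z) : S.AllLt x z :=
  fun i => (h i).trans (h' i)

/-- `x` and `y` are in the same position relative to `w` in every order. -/
def SamePat (S : PermStruct n Γ) (w x y : Γ) : Prop :=
  ∀ i, (S.le i w x ↔ S.le i w y) ∧ (S.le i x w ↔ S.le i y w)

/-- `x` and `y` have the same quantifier-free type over `A`. -/
def TypeOver (S : PermStruct n Γ) (A : Set Γ) (x y : Γ) : Prop := ∀ s ∈ A, S.SamePat s x y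

lemma SamePat.refl (w x : Γ) : S.SamePat w x x := fun _ => ⟨Iff.rfl, Iff.rfl⟩

lemma SamePat.symm {w x y : Γ} (h : S.SamePat w x y) : S.SamePat w y x :=
  fun i => ⟨(h i).1.symm, (h i).2.symm⟩

lemma SamePat.trans {w x y z : Γ} (h : S.SamePat w x y) (h' : S.SamePat w y z) :
    S.SamePat w x z :=
  fun i => ⟨(h i).1.trans (h' i).1, (h i).2.trans (h' i).2⟩

lemma TypeOver.refl (A : Set Γ) (x : Γ) : S.TypeOver A x x := fun _ _ => .refl _ _

lemma TypeOver.symm {A : Set Γ} {x y : Γ} (h : S.TypeOver A x y) : S.TypeOver A y x :=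
  fun s hs => (h s hs).symm

lemma TypeOver.trans {A : Set Γ} {x y z : Γ} (h : S.TypeOver A x y) (h' : S.TypeOver A y z) :
    S.TypeOver A x z :=
  fun s hs => (h s hs).trans (h' s hs)

lemma TypeOver.mono {A B : Set Γ} {x y : Γ} (h : S.TypeOver B x y) (hAB : A ⊆ B) :
    S.TypeOver A x y :=
  fun s hs => h s (hAB hs)

lemma IsAuto.symm {σ : Γ ≃ Γ} (h : S.IsAuto σ) : S.IsAuto σ.symm := by
  intro i x y
  simpa using (h i (σ.symm x) (σ.symm y)).symm

lemma IsAuto.trans {σ τ : Γ ≃ Γ} (h : S.IsAuto σ) (h' : S.IsAuto τ) : S.IsAuto (σ.trans τ) :=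
  fun i x y => (h i x y).trans (h' i _ _)

lemma isAuto_refl : S.IsAuto (Equiv.refl Γ) := fun _ _ _ => Iff.rfl

lemma IsAuto.lt_iff {σ : Γ ≃ Γ} (h : S.IsAuto σ) (i : Fin n) (x y : Γ) :
    S.lt i (σ x) (σ y) ↔ S.lt i x y := not_congr (h i y x).symm

lemma IsAuto.allLt_iff {σ : Γ ≃ Γ} (h : S.IsAuto σ) (x y : Γ) :
    S.AllLt (σ x) (σ y) ↔ S.AllLt x y := forall_congr' fun i => h.lt_iff i x y

lemma IsAuto.samePat_iff {σ : Γ ≃ Γ} (h : S.IsAuto σ) (w x y : Γ) :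
    S.SamePat (σ w) (σ x) (σ y) ↔ S.SamePat w x y :=
  forall_congr' fun i => by rw [← h i, ← h i, ← h i, ← h i]

lemma IsAuto.typeOver_apply {σ : Γ ≃ Γ} (h : S.IsAuto σ) {A : Set Γ} (hA : ∀ s ∈ A, σ s = s)
    (x : Γ) : S.TypeOver A x (σ x) := by
  intro s hs i
  have h1 := h i s x
  have h2 := h i x s
  rw [hA s hs] at h1 h2
  exact ⟨h1, h2⟩

/-- Homogeneity, phrased for finite partial isomorphisms given as relations. -/
lemma Homogeneous.ext_rel (hn : 0 < n) (hh : S.Homogeneous) {P : Set (Γ × Γ)} (hP : P.Finite)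
    (h : ∀ p ∈ P, ∀ q ∈ P, ∀ i, S.le i p.1 q.1 ↔ S.le i p.2 q.2) :
    ∃ σ : Γ ≃ Γ, S.IsAuto σ ∧ ∀ p ∈ P, σ p.1 = p.2 := by
  classical
  have i₀ : Fin n := ⟨0, hn⟩
  let f : Γ → Γ := fun x => if h : ∃ y, (x, y) ∈ P then h.choose else x
  have hf : ∀ p ∈ P, f p.1 = p.2 := by
    intro p hp
    have hex : ∃ y, (p.1, y) ∈ P := ⟨p.2, hp⟩
    have hc := hex.choose_spec
    have hfp : f p.1 = hex.choose := dif_pos hex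
    rw [hfp]
    exact S.antisymm i₀ _ _ ((h _ hc _ hp i₀).1 (S.le_self _ _))
      ((h _ hp _ hc i₀).1 (S.le_self _ _))
  have hinj : Set.InjOn f (hP.image Prod.fst).toFinset := by
    intro x hx y hy hxy
    simp only [Set.Finite.coe_toFinset, Set.mem_image] at hx hy
    obtain ⟨p, hp, rfl⟩ := hx
    obtain ⟨q, hq, rfl⟩ := hy
    rw [hf p hp, hf q hq] at hxy
    exact S.antisymm i₀ _ _ ((h _ hp _ hq i₀).2 (hxy ▸ S.le_self _ _))
      ((h _ hq _ hp i₀).2 (hxy ▸ S.le_self _ _))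
  obtain ⟨σ, hσ, hσf⟩ := hh (hP.image Prod.fst).toFinset f hinj (by
    intro i x hx y hy
    simp only [Set.Finite.mem_toFinset, Set.mem_image] at hx hy
    obtain ⟨p, hp, rfl⟩ := hx
    obtain ⟨q, hq, rfl⟩ := hy
    rw [hf p hp, hf q hq]
    exact h p hp q hq i)
  exact ⟨σ, hσ, fun p hp => (hσf _ (by simpa using ⟨p.2, hp⟩)).trans (hf p hp)⟩

/-- Homogeneity over a finite set of parameters. -/
lemma Homogeneous.ext_over (hn : 0 < n) (hh : S.Homogeneous) {A : Set Γ} (hA : A.Finite)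
    {κ : Type*} [Finite κ] (u v : κ → Γ) (huv : ∀ k, S.TypeOver A (u k) (v k))
    (h : ∀ i j k, S.le i (u j) (u k) ↔ S.le i (v j) (v k)) :
    ∃ σ : Γ ≃ Γ, S.IsAuto σ ∧ (∀ s ∈ A, σ s = s) ∧ ∀ k, σ (u k) = v k := by
  have hP : ∀ p ∈ (fun s => (s, s)) '' A ∪ Set.range fun k => (u k, v k),
      ∀ q ∈ (fun s => (s, s)) '' A ∪ Set.range fun k => (u k, v k),
      ∀ i, S.le i p.1 q.1 ↔ S.le i p.2 q.2 := by
    rintro _ (⟨s, hs, rfl⟩ | ⟨k, rfl⟩) _ (⟨t, ht, rfl⟩ | ⟨l, rfl⟩) i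
    · exact Iff.rfl
    · exact (huv l s hs i).1
    · exact (huv k t ht i).2
    · exact h i k l
  obtain ⟨σ, hσ, hσP⟩ := hh.ext_rel hn ((hA.image _).union (Set.finite_range _)) hP
  exact ⟨σ, hσ, fun s hs => hσP (s, s) (.inl ⟨s, hs, rfl⟩),
    fun k => hσP (u k, v k) (.inr ⟨k, rfl⟩)⟩

lemma Homogeneous.ext_one (hn : 0 < n) (hh : S.Homogeneous) {A : Set Γ} (hA : A.Finite)
    {x y : Γ} (h : S.TypeOver A x y) :
    ∃ σ : Γ ≃ Γ, S.IsAuto σ ∧ (∀ s ∈ A, σ s = s) ∧ σ x = y := by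
  obtain ⟨σ, hσ, hσA, hσx⟩ := hh.ext_over hn hA (fun _ : Unit => x) (fun _ => y) (fun _ => h)
    (fun i _ _ => iff_of_true (S.le_self _ _) (S.le_self _ _))
  exact ⟨σ, hσ, hσA, hσx ()⟩

/-- Two increasing chains of the same length whose entries pairwise have the same type over `A`
are conjugate over `A`. -/
lemma Homogeneous.ext_chain (hn : 0 < n) (hh : S.Homogeneous) {A : Set Γ} (hA : A.Finite)
    {m : ℕ} (u v : Fin m → Γ) (huv : ∀ k, S.TypeOver A (u k) (v k))
    (hu : ∀ j k, j < k → S.AllLt (u j) (u k)) (hv : ∀ j k, j < k → S.AllLt (v j) (v k)) :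
    ∃ σ : Γ ≃ Γ, S.IsAuto σ ∧ (∀ s ∈ A, σ s = s) ∧ ∀ k, σ (u k) = v k := by
  refine hh.ext_over hn hA u v huv fun i j k => ?_
  rcases lt_trichotomy j k with h | rfl | h
  · exact iff_of_true (hu _ _ h i).le (hv _ _ h i).le
  · exact iff_of_true (S.le_self _ _) (S.le_self _ _)
  · exact iff_of_false (hu _ _ h i) (hv _ _ h i)

lemma exists_auto_apply (hn : 0 < n) (hh : S.Homogeneous) (x y : Γ) :
    ∃ σ : Γ ≃ Γ, S.IsAuto σ ∧ σ x = y := by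
  obtain ⟨σ, hσ, -, h⟩ := hh.ext_one hn (A := ∅) Set.finite_empty (x := x) (y := y)
    (by simp [TypeOver])
  exact ⟨σ, hσ, h⟩

/-- A homogeneous permutation structure, of positive dimension, with a `∅`-definable equivalence
relation. -/
structure HomogeneousEquiv (S : PermStruct n Γ) (E : Γ → Γ → Prop) : Prop where
  pos : 0 < n
  hom : S.Homogeneous
  defn : S.Definable E
  equiv : Equivalence E

/-- `a` and `b` are conjugate by an automorphism fixing `A` pointwise and the class of `w`. -/
def Conj (S : PermStruct n Γ) (E : Γ → Γ → Prop) (A : Set Γ) (w a b : Γ) : Prop :=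
  ∃ h : Γ ≃ Γ, S.IsAuto h ∧ (∀ s ∈ A, h s = s) ∧ h a = b ∧ E w (h w)

/-- Every finite part of the class of `w` has a copy in that class, all of whose elements lie in
the cut of `w` over `B`. -/
def Good (S : PermStruct n Γ) (E : Γ → Γ → Prop) (B : Set Γ) (w : Γ) : Prop :=
  ∀ V : Set Γ, V.Finite → (∀ v ∈ V, E w v) → ∃ σ : Γ ≃ Γ, S.IsAuto σ ∧ (∀ v ∈ V, E w (σ v)) ∧
    ∀ v ∈ V, ∀ s ∈ B, ∀ i, S.le i s (σ v) ↔ S.le i s w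

namespace HomogeneousEquiv

lemma map_iff (H : S.HomogeneousEquiv E) {σ : Γ ≃ Γ} (hσ : S.IsAuto σ) {x y : Γ} :
    E (σ x) (σ y) ↔ E x y := (H.defn σ hσ x y).symm

lemma map_symm (H : S.HomogeneousEquiv E) {σ : Γ ≃ Γ} (hσ : S.IsAuto σ) {x y : Γ}
    (h : E x (σ y)) : E (σ.symm x) y := by
  rw [← H.map_iff hσ]
  simpa using h

lemma conj_symm (H : S.HomogeneousEquiv E) {A : Set Γ} {w a b : Γ} (h : S.Conj E A w a b) :
    S.Conj E A w b a := by
  obtain ⟨φ, hφ, hA, rfl, hw⟩ := h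
  refine ⟨φ.symm, hφ.symm, fun s hs => ?_, by simp, H.equiv.symm (H.map_symm hφ hw)⟩
  rw [Equiv.symm_apply_eq, hA s hs]

lemma conj_trans (H : S.HomogeneousEquiv E) {A : Set Γ} {w a b c : Γ} (h : S.Conj E A w a b)
    (h' : S.Conj E A w b c) : S.Conj E A w a c := by
  obtain ⟨φ, hφ, hA, rfl, hw⟩ := h
  obtain ⟨ψ, hψ, hA', rfl, hw'⟩ := h'
  exact ⟨φ.trans ψ, hφ.trans hψ, fun s hs => by simp [hA s hs, hA' s hs], rfl,
    H.equiv.trans hw' ((H.map_iff hψ).2 hw)⟩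

lemma conj_of_rel (H : S.HomogeneousEquiv E) {A : Set Γ} {w w' a b : Γ} (h : S.Conj E A w a b)
    (hw : E w w') : S.Conj E A w' a b := by
  obtain ⟨φ, hφ, hA, rfl, hφw⟩ := h
  exact ⟨φ, hφ, hA, rfl, H.equiv.trans (H.equiv.symm hw)
    (H.equiv.trans hφw ((H.map_iff hφ).2 hw))⟩

lemma conj_map (H : S.HomogeneousEquiv E) {A : Set Γ} {w a b : Γ} {φ : Γ ≃ Γ} (hφ : S.IsAuto φ)
    (hA : ∀ s ∈ A, φ s = s) (h : S.Conj E A w a b) : S.Conj E A (φ w) (φ a) (φ b) := by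
  obtain ⟨ψ, hψ, hA', rfl, hw⟩ := h
  refine ⟨(φ.symm.trans ψ).trans φ, (hφ.symm.trans hψ).trans hφ, fun s hs => ?_, by simp,
    by simpa using (H.map_iff hφ).2 hw⟩
  have : φ.symm s = s := by rw [Equiv.symm_apply_eq, hA s hs]
  simp [this, hA s hs, hA' s hs]

lemma conj_map_iff (H : S.HomogeneousEquiv E) {A : Set Γ} {w a b : Γ} {φ : Γ ≃ Γ}
    (hφ : S.IsAuto φ) (hA : ∀ s ∈ A, φ s = s) :
    S.Conj E A (φ w) (φ a) (φ b) ↔ S.Conj E A w a b := by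
  refine ⟨fun h => ?_, H.conj_map hφ hA⟩
  have := H.conj_map hφ.symm (fun s hs => by rw [Equiv.symm_apply_eq, hA s hs]) h
  simpa using this

lemma conj_of_type (H : S.HomogeneousEquiv E) {A : Set Γ} (hA : A.Finite) {w a b : Γ}
    (h : S.TypeOver A a b) (hw : S.SamePat w a b) : S.Conj E A w a b := by
  have h' : S.TypeOver (insert w A) a b := by
    rintro s (rfl | hs)
    · exact hw
    · exact h s hs
  obtain ⟨σ, hσ, hσA, hab⟩ := H.hom.ext_one H.pos (hA.insert w) h'
  exact ⟨σ, hσ, fun s hs => hσA s (.inr hs), hab, by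
    rw [hσA w (.inl rfl)]
    exact H.equiv.refl w⟩

lemma good_map (H : S.HomogeneousEquiv E) {B : Set Γ} {w : Γ} {φ : Γ ≃ Γ} (hφ : S.IsAuto φ)
    (h : S.Good E B w) : S.Good E (φ '' B) (φ w) := by
  intro V hV hVw
  obtain ⟨σ, hσ, hσV, hσB⟩ := h (φ.symm '' V) (hV.image _) (by
    rintro _ ⟨v, hv, rfl⟩
    rw [← H.map_iff hφ]
    simpa using hVw v hv)
  refine ⟨(φ.symm.trans σ).trans φ, (hφ.symm.trans hσ).trans hφ, fun v hv => ?_, ?_⟩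
  · simpa using (H.map_iff hφ).2 (hσV _ ⟨v, hv, rfl⟩)
  · rintro v hv _ ⟨s, hs, rfl⟩ i
    have := hσB _ ⟨v, hv, rfl⟩ s hs i
    rw [hφ i s, hφ i s] at this
    simpa using this

lemma exists_lt (H : S.HomogeneousEquiv E) {c c' : Γ} (hc : E c c') (hne : c ≠ c') (i : Fin n)
    (v : Γ) : ∃ v', E v v' ∧ S.lt i v v' := by
  rcases lt_or_lt_of_ne (S := S) i hne with h | h
  · obtain ⟨σ, hσ, rfl⟩ := S.exists_auto_apply H.pos H.hom c v
    exact ⟨σ c', (H.map_iff hσ).2 hc, (hσ.lt_iff i _ _).2 h⟩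
  · obtain ⟨σ, hσ, rfl⟩ := S.exists_auto_apply H.pos H.hom c' v
    exact ⟨σ c, (H.map_iff hσ).2 (H.equiv.symm hc), (hσ.lt_iff i _ _).2 h⟩

/-- A finite part of a class has a copy in the class on one side of finitely many cuts. -/
lemma exists_same_cut (H : S.HomogeneousEquiv E) {c c' : Γ} (hc : E c c') (hne : c ≠ c')
    (Q : Finset (Γ × Fin n)) : ∀ V : Set Γ, V.Finite → (∀ v ∈ V, E c v) →
      ∃ σ : Γ ≃ Γ, S.IsAuto σ ∧ (∀ v ∈ V, E c (σ v)) ∧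
        ∀ p ∈ Q, ∀ v ∈ V, ∀ v' ∈ V, S.le p.2 p.1 (σ v) ↔ S.le p.2 p.1 (σ v') := by
  classical
  induction Q using Finset.induction_on with
  | empty => exact fun V _ hVc => ⟨Equiv.refl Γ, isAuto_refl, hVc, by simp⟩
  | insert p Q _ ih =>
    intro V hV hVc
    rcases V.eq_empty_or_nonempty with rfl | hVne
    · exact ⟨Equiv.refl Γ, isAuto_refl, by simp, by simp⟩
    obtain ⟨s, i⟩ := p
    obtain ⟨u, huV, hu⟩ : ∃ u ∈ V, ∀ v ∈ V, S.le i u v :=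
      letI := S.lin i
      Set.exists_min_image V id hV hVne
    obtain ⟨t, htV, ht⟩ : ∃ t ∈ V, ∀ v ∈ V, S.le i v t :=
      letI := S.lin i
      Set.exists_max_image V id hV hVne
    obtain ⟨t', htt', hlt⟩ := H.exists_lt hc hne i t
    obtain ⟨τ, hτ, hτu⟩ := S.exists_auto_apply H.pos H.hom u t'
    have hcτ : ∀ x, E c x → E c (τ x) := by
      intro x hx
      refine H.equiv.trans (H.equiv.trans (hVc t htV) htt') ?_
      rw [← hτu, H.map_iff hτ]
      exact H.equiv.trans (H.equiv.symm (hVc u huV)) hx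
    have hVτ : ∀ x ∈ V, ∀ y ∈ V, S.lt i y (τ x) := fun x hx y hy =>
      lt_of_lt_of_le (lt_of_le_of_lt (ht y hy) hlt) (hτu ▸ (hτ i _ _).1 (hu x hx))
    obtain ⟨σ, hσ, hσc, hσQ⟩ := ih (V ∪ τ '' V) (hV.union (hV.image _)) (by
      rintro _ (hv | ⟨v, hv, rfl⟩)
      · exact hVc _ hv
      · exact hcτ v (hVc v hv))
    by_cases hcut : ∀ v ∈ V, ∀ v' ∈ V, S.le i s (σ v) ↔ S.le i s (σ v')
    · refine ⟨σ, hσ, fun v hv => hσc v (.inl hv), fun p hp v hv v' hv' => ?_⟩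
      rcases Finset.mem_insert.1 hp with rfl | hp
      · exact hcut v hv v' hv'
      · exact hσQ p hp v (.inl hv) v' (.inl hv')
    · obtain ⟨v₁, hv₁, hs⟩ : ∃ v ∈ V, S.le i s (σ v) := by
        by_contra! hno
        exact hcut fun v hv v' hv' => iff_of_false (hno v hv) (hno v' hv')
      have hle : ∀ v ∈ V, S.le i s (σ (τ v)) := fun v hv =>
        S.trans i _ _ _ hs ((hσ i _ _).1 (hVτ v hv v₁ hv₁).le)
      refine ⟨τ.trans σ, hτ.trans hσ, fun v hv => hσc _ (.inr ⟨v, hv, rfl⟩),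
        fun p hp v hv v' hv' => ?_⟩
      rcases Finset.mem_insert.1 hp with rfl | hp
      · exact iff_of_true (hle v hv) (hle v' hv')
      · exact hσQ p hp _ (.inr ⟨v, hv, rfl⟩) _ (.inr ⟨v', hv', rfl⟩)

/-- Every class with at least two elements contains a good point over a given finite set. -/
lemma exists_good (H : S.HomogeneousEquiv E) {c c' : Γ} (hc : E c c') (hne : c ≠ c')
    {B : Set Γ} (hB : B.Finite) : ∃ w, E c w ∧ S.Good E B w := by
  classical
  by_contra! hbad
  simp only [Good] at hbad
  push Not at hbad
  choose! V hV hVw hbad using hbad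
  have : Finite B := hB
  let ty : Γ → B → Fin n → Prop := fun w s i => S.le i s w
  obtain ⟨R, hRc, hR⟩ := Set.exists_subset_bijOn {w | E c w} ty
  have hRfin : R.Finite := hR.finite_iff_finite.2 (Set.toFinite _)
  obtain ⟨σ, hσ, hσc, hσQ⟩ := H.exists_same_cut hc hne (hB.toFinset ×ˢ Finset.univ)
    (insert c (⋃ w ∈ R, V w)) ((hRfin.biUnion fun w hw => hV w (hRc hw)).insert c) (by
      rintro v (rfl | hv)
      · exact H.equiv.refl _
      · simp only [Set.mem_iUnion] at hv
        obtain ⟨w, hw, hv⟩ := hv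
        exact H.equiv.trans (hRc hw) (hVw w (hRc hw) v hv))
  obtain ⟨r, hr, hrσ⟩ := hR.surjOn ⟨σ c, hσc c (.inl rfl), rfl⟩
  have hmem : ∀ v ∈ V r, v ∈ insert c (⋃ w ∈ R, V w) := fun v hv =>
    .inr (Set.mem_biUnion hr hv)
  obtain ⟨v, hv, s, hs, i, hi⟩ := hbad r (hRc hr) σ hσ fun v hv =>
    H.equiv.trans (H.equiv.symm (hRc hr)) (hσc v (hmem v hv))
  have h1 := hσQ (s, i) (by simpa using hs) v (hmem v hv) c (.inl rfl)
  have h2 : S.le i s r ↔ S.le i s (σ c) := iff_of_eq (congrFun (congrFun hrσ ⟨s, hs⟩) i)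
  simp only at h1
  tauto

end HomogeneousEquiv

lemma SamePat.of_le {w x y : Γ} (h : ∀ i, S.le i w x ↔ S.le i w y) (hx : w ≠ x) (hy : w ≠ y) :
    S.SamePat w x y := fun i => by
  refine ⟨h i, ?_⟩
  have key : ∀ {z : Γ}, w ≠ z → (S.le i z w ↔ ¬ S.le i w z) := fun hz =>
    ⟨fun h1 h2 => hz (S.antisymm i _ _ h2 h1), fun h1 => (S.total i _ _).resolve_left h1⟩
  rw [key hx, key hy, h i]

lemma SamePat.lt_left {w x y : Γ} (h : S.SamePat w x y) (i : Fin n) :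
    S.lt i w x ↔ S.lt i w y := not_congr (h i).2

lemma SamePat.lt_right {w x y : Γ} (h : S.SamePat w x y) (i : Fin n) :
    S.lt i x w ↔ S.lt i y w := not_congr (h i).1

namespace HomogeneousEquiv

/-- A good configuration `B` around the class of `w` can be moved, fixing `B₀`, so that all points
of `Y` (which resemble `w` over `B₀`) see the image of `B` as `w` sees `B`, while the image of
the class of `w` spreads around `Y`. -/
lemma exists_nest (H : S.HomogeneousEquiv E) {B₀ B Y : Set Γ} (hB₀ : B₀ ⊆ B) (hB : B.Finite)
    (hY : Y.Finite) {a b w : Γ} (ha : a ∈ B₀) (hb : b ∈ B₀) (hBa : ∀ s ∈ B, E a s)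
    (haw : ¬ E a w) (hgood : S.Good E B w) (hYw : ∀ y ∈ Y, S.TypeOver B₀ w y) :
    ∃ (θ : Γ ≃ Γ) (m m' : Γ), S.IsAuto θ ∧ (∀ s ∈ B₀, θ s = s) ∧ E (θ w) m ∧ E (θ w) m' ∧
      S.TypeOver B₀ w m ∧ S.TypeOver B₀ w m' ∧
      (∀ y ∈ Y, ∀ s ∈ B, ∀ i,
        (S.le i (θ s) y ↔ S.le i s w) ∧ (S.le i y (θ s) ↔ S.le i w s)) ∧
      ∀ y ∈ Y, ∀ i, S.lt i a w → S.lt i w b → S.lt i m y ∧ S.lt i y m' := by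
  have hdn : ∀ y i, ∃ u, E a u ∧ ∀ u', E a u' → S.lt i u' y → S.lt i u y := fun y i => by
    by_cases h : ∃ u', E a u' ∧ S.lt i u' y
    · obtain ⟨u, hu, huy⟩ := h
      exact ⟨u, hu, fun _ _ _ => huy⟩
    · push Not at h
      exact ⟨a, H.equiv.refl a, fun u' hu' hlt => (h u' hu' hlt).elim⟩
  have hup : ∀ y i, ∃ u, E a u ∧ ∀ u', E a u' → S.lt i y u' → S.lt i y u := fun y i => by
    by_cases h : ∃ u', E a u' ∧ S.lt i y u'
    · obtain ⟨u, hu, huy⟩ := h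
      exact ⟨u, hu, fun _ _ _ => huy⟩
    · push Not at h
      exact ⟨a, H.equiv.refl a, fun u' hu' hlt => (h u' hu' hlt).elim⟩
  choose dn hdnE hdn using hdn
  choose up hupE hup using hup
  let V : Set Γ := {a, b} ∪ (Set.image2 dn Y Set.univ ∪ Set.image2 up Y Set.univ)
  have hVfin : V.Finite := (Set.toFinite _).union
    ((hY.image2 _ Set.finite_univ).union (hY.image2 _ Set.finite_univ))
  have hVa : ∀ v ∈ V, E a v := by
    rintro v ((rfl | rfl) | ⟨y, -, i, -, rfl⟩ | ⟨y, -, i, -, rfl⟩)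
    · exact H.equiv.refl _
    · exact hBa _ (hB₀ hb)
    · exact hdnE y i
    · exact hupE y i
  obtain ⟨κ, hκ, hκa⟩ := S.exists_auto_apply H.pos H.hom a w
  obtain ⟨σ, hσ, hσw, hσB⟩ := hgood (κ '' V) (hVfin.image _) (by
    rintro _ ⟨v, hv, rfl⟩
    rw [← hκa, H.map_iff hκ]
    exact hVa v hv)
  obtain ⟨τ, hτ, hτw, hτV⟩ : ∃ τ : Γ ≃ Γ, S.IsAuto τ ∧ E (τ w) a ∧
      ∀ v ∈ V, ∀ s ∈ B, ∀ i, (S.le i (τ s) v ↔ S.le i s w) ∧ (S.le i v (τ s) ↔ S.le i w s) := by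
    refine ⟨(κ.trans σ).symm, (hκ.trans hσ).symm, H.map_symm (hκ.trans hσ)
      (hσw _ ⟨a, .inl (.inl rfl), rfl⟩), fun v hv s hs i => ?_⟩
    rw [(hκ.trans hσ) i _ v, (hκ.trans hσ) i v _]
    simp only [Equiv.apply_symm_apply]
    refine SamePat.of_le (fun i => hσB _ ⟨v, hv, rfl⟩ s hs i) ?_ ?_ i
    · rintro rfl
      exact haw (H.equiv.trans (hBa _ hs) (H.equiv.symm (hσw _ ⟨v, hv, rfl⟩)))
    · rintro rfl
      exact haw (hBa _ hs)
  have hψ : ∀ y ∈ Y, ∃ ψ : Γ ≃ Γ, S.IsAuto ψ ∧ (∀ s, E a s → E a (ψ s)) ∧ ψ w = y := by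
    intro y hy
    obtain ⟨ψ, hψ, hψB, hψy⟩ := H.hom.ext_one H.pos (hB.subset hB₀) (hYw y hy)
    exact ⟨ψ, hψ, fun s hs => hψB a ha ▸ (H.map_iff hψ).2 hs, hψy⟩
  have hlt : ∀ y ∈ Y, ∀ s ∈ B, ∀ i, S.lt i s w → S.lt i (τ s) y := by
    intro y hy s hs i hsw
    obtain ⟨ψ, hψ, hψE, rfl⟩ := hψ y hy
    have h1 := hdn (ψ w) i (ψ s) (hψE s (hBa s hs)) ((hψ.lt_iff i _ _).2 hsw)
    exact lt_of_le_of_lt ((hτV _ (.inr (.inl ⟨_, hy, i, trivial, rfl⟩)) s hs i).1.2 hsw.le) h1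
  have hgt : ∀ y ∈ Y, ∀ s ∈ B, ∀ i, S.lt i w s → S.lt i y (τ s) := by
    intro y hy s hs i hsw
    obtain ⟨ψ, hψ, hψE, rfl⟩ := hψ y hy
    have h1 := hup (ψ w) i (ψ s) (hψE s (hBa s hs)) ((hψ.lt_iff i _ _).2 hsw)
    exact lt_of_lt_of_le h1 ((hτV _ (.inr (.inr ⟨_, hy, i, trivial, rfl⟩)) s hs i).2.2 hsw.le)
  have hτY : ∀ y ∈ Y, ∀ s ∈ B, ∀ i,
      (S.le i (τ s) y ↔ S.le i s w) ∧ (S.le i y (τ s) ↔ S.le i w s) := by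
    intro y hy s hs i
    have hne : s ≠ w := by
      rintro rfl
      exact haw (hBa _ hs)
    rcases lt_or_lt_of_ne (S := S) i hne with h | h
    · have h' := hlt y hy s hs i h
      exact ⟨iff_of_true h'.le h.le, iff_of_false h' h⟩
    · have h' := hgt y hy s hs i h
      exact ⟨iff_of_false h' h, iff_of_true h'.le h.le⟩
  obtain ⟨ρ, hρ, hρP⟩ := H.hom.ext_rel H.pos
    (P := (fun s => (τ s, s)) '' B₀ ∪ (fun y => (y, y)) '' Y)
    (((hB.subset hB₀).image _).union (hY.image _)) (by
      rintro _ (⟨s, hs, rfl⟩ | ⟨y, hy, rfl⟩) _ (⟨t, ht, rfl⟩ | ⟨z, hz, rfl⟩) i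
      · exact (hτ i s t).symm
      · exact (hτY z hz s (hB₀ hs) i).1.trans (hYw z hz s hs i).1
      · exact (hτY y hy t (hB₀ ht) i).2.trans (hYw y hy t ht i).2
      · exact Iff.rfl)
  have hρs : ∀ s ∈ B₀, ρ (τ s) = s := fun s hs => hρP (τ s, s) (.inl ⟨s, hs, rfl⟩)
  have hρy : ∀ y ∈ Y, ρ y = y := fun y hy => hρP (y, y) (.inr ⟨y, hy, rfl⟩)
  have htype : ∀ v ∈ V, S.TypeOver B₀ w (ρ v) := by
    intro v hv s hs i
    have h1 := hρ i (τ s) v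
    have h2 := hρ i v (τ s)
    rw [hρs s hs] at h1 h2
    have h3 := hτV v hv s (hB₀ hs) i
    exact ⟨h3.1.symm.trans h1, h3.2.symm.trans h2⟩
  refine ⟨τ.trans ρ, ρ a, ρ b, hτ.trans hρ, hρs, (H.map_iff hρ).2 hτw,
    (H.map_iff hρ).2 (H.equiv.trans hτw (hBa b (hB₀ hb))), htype a (.inl (.inl rfl)),
    htype b (.inl (.inr rfl)), fun y hy s hs i => ?_, fun y hy i haw hwb => ?_⟩
  · have h1 := hρ i (τ s) y
    have h2 := hρ i y (τ s)
    rw [hρy y hy] at h1 h2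
    have h3 := hτY y hy s hs i
    exact ⟨h1.symm.trans h3.1, h2.symm.trans h3.2⟩
  · have h1 := hρ.lt_iff i a y
    have h2 := hρ.lt_iff i y b
    rw [hρy y hy] at h1 h2
    exact ⟨h1.2 (((hYw y hy a ha).lt_left i).1 haw), h2.2 (((hYw y hy b hb).lt_right i).1 hwb)⟩

lemma _root_.PermStruct.SamePat.of_lt {w x y : Γ}
    (h : ∀ i, (S.lt i w x ∧ S.lt i w y) ∨ (S.lt i x w ∧ S.lt i y w)) :
    S.SamePat w x y := fun i => by
  rcases h i with ⟨h1, h2⟩ | ⟨h1, h2⟩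
  · exact ⟨iff_of_true h1.le h2.le, iff_of_false h1 h2⟩
  · exact ⟨iff_of_false h1 h2, iff_of_true h1.le h2.le⟩

lemma conj_of_chain (H : S.HomogeneousEquiv E) {A : Set Γ} (hA : A.Finite) {a c₁ c₂ b w : Γ}
    (hAa : ∀ s ∈ A, E a s) (hab : E a b) (hac₁ : S.AllLt a c₁) (hc₁c₂ : S.AllLt c₁ c₂)
    (hc₂b : S.AllLt c₂ b) (h₁ : S.TypeOver A a c₁) (h₂ : S.TypeOver A a c₂)
    (hb : S.TypeOver A a b) (haw : ¬ E a w) (hgood : S.Good E (insert a (insert b A)) w)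
    (hw₁ : S.SamePat w a c₁) (hw₂ : S.SamePat w c₂ b) : S.Conj E A w a b := by
  have hc₁b := hc₁c₂.trans hc₂b
  have hac₂ := hac₁.trans hc₁c₂
  have hab' := hac₁.trans hc₁b
  obtain ⟨κ, hκ, hκA, hκc⟩ := H.hom.ext_chain H.pos hA ![a, c₂, b] ![a, c₁, b]
    (by simpa [Fin.forall_fin_succ, TypeOver.refl] using h₂.symm.trans h₁)
    (by simp [Fin.forall_fin_succ, *]) (by simp [Fin.forall_fin_succ, *])
  have hκa : κ a = a := hκc 0
  have hκc₂ : κ c₂ = c₁ := hκc 1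
  have hκb : κ b = b := hκc 2
  set B : Set Γ := insert a (insert b A)
  have haB : a ∈ B := .inl rfl
  have hbB : b ∈ B := .inr (.inl rfl)
  have hκB : ∀ s ∈ B, κ s = s := by
    rintro s (rfl | rfl | hs)
    exacts [hκa, hκb, hκA s hs]
  have hBa : ∀ s ∈ B, E a s := by
    rintro s (rfl | rfl | hs)
    exacts [H.equiv.refl _, hab, hAa s hs]
  have hy := hκ.typeOver_apply hκB w
  obtain ⟨θ, m, m', hθ, hθB, hm, hm', hmB, hmB', -, hlt⟩ := H.exists_nest (B₀ := B) (B := B)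
    (Y := {κ w, w}) subset_rfl ((hA.insert b).insert a) (Set.toFinite _) haB hbB hBa haw hgood (by
      rintro y (rfl | rfl)
      exacts [hy, .refl _ _])
  have hane : a ≠ w := by
    rintro rfl
    exact haw (H.equiv.refl _)
  have hbne : b ≠ w := by
    rintro rfl
    exact haw hab
  have hyc : S.SamePat (κ w) c₁ b := by
    have h := (hκ.samePat_iff w c₂ b).2 hw₂
    rwa [hκc₂, hκb] at h
  have hmb : S.SamePat m b c₁ := .of_lt fun i => by
    rcases lt_or_lt_of_ne (S := S) i hane with h1 | h1
    · rcases lt_or_lt_of_ne (S := S) i hbne with h2 | h2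
      · have h3 := ((hmB b hbB).lt_left i).1 h2
        exact .inr ⟨h3, (hc₁b i).trans h3⟩
      · have h3 := (hlt (κ w) (.inl rfl) i h1 h2).1
        have h4 := ((hy b hbB).lt_right i).1 h2
        exact .inl ⟨h3.trans h4, h3.trans ((hyc.lt_left i).2 h4)⟩
    · have h3 := ((hmB a haB).lt_right i).1 h1
      exact .inl ⟨h3.trans (hab' i), h3.trans (hac₁ i)⟩
  have hma : S.SamePat m' a c₁ := .of_lt fun i => by
    rcases lt_or_lt_of_ne (S := S) i hane with h1 | h1
    · rcases lt_or_lt_of_ne (S := S) i hbne with h2 | h2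
      · have h3 := ((hmB' b hbB).lt_left i).1 h2
        exact .inr ⟨(hab' i).trans h3, (hc₁b i).trans h3⟩
      · have h3 := (hlt w (.inr rfl) i h1 h2).2
        exact .inr ⟨h1.trans h3, ((hw₁.lt_right i).1 h1).trans h3⟩
    · have h3 := ((hmB' a haB).lt_right i).1 h1
      exact .inl ⟨h3, h3.trans (hac₁ i)⟩
  have hcm := H.conj_of_rel (H.conj_of_type hA (hb.symm.trans h₁) hmb) (H.equiv.symm hm)
  have hcm' := H.conj_of_rel (H.conj_of_type hA h₁ hma) (H.equiv.symm hm')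
  rw [← H.conj_map_iff hθ fun s hs => hθB s (.inr (.inr hs)), hθB a haB, hθB b hbB]
  exact H.conj_trans hcm' (H.conj_symm hcm)

lemma _root_.PermStruct.Good.mono {B B' : Set Γ} {w : Γ} (h : S.Good E B w) (hB : B' ⊆ B) :
    S.Good E B' w := fun V hV hVw => by
  obtain ⟨σ, hσ, hσV, hσB⟩ := h V hV hVw
  exact ⟨σ, hσ, hσV, fun v hv s hs => hσB v hv s (hB hs)⟩

lemma _root_.PermStruct.exists_samePat (n : ℕ) : ∃ K : ℕ, ∀ {Γ : Type*} (S : PermStruct n Γ) (w : Γ)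
    (x : ℕ → Γ), ∃ j k, j < k ∧ k ≤ K ∧ S.SamePat w (x j) (x k) := by
  classical
  refine ⟨Fintype.card (Fin n → Prop × Prop), fun S w x => ?_⟩
  obtain ⟨j, k, hjk, h⟩ := Fintype.exists_ne_map_eq_of_card_lt
    (fun (j : Fin (Fintype.card (Fin n → Prop × Prop) + 1)) (i : Fin n) =>
      (S.le i w (x j), S.le i (x j) w)) (by simp)
  have h' : S.SamePat w (x j) (x k) := fun i => by
    have := congrFun h i
    simp only [Prod.mk.injEq, eq_iff_iff] at this
    exact this
  rcases lt_or_gt_of_ne hjk with hlt | hlt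
  · exact ⟨j, k, hlt, Nat.lt_succ_iff.1 k.2, h'⟩
  · exact ⟨k, j, hlt, Nat.lt_succ_iff.1 j.2, h'.symm⟩

/-- `x` lies strictly below `y` in the orders selected by `P`, and strictly above in the others. -/
def _root_.PermStruct.SignedLt (S : PermStruct n Γ) (P : Fin n → Prop) (x y : Γ) : Prop :=
  ∀ i, (P i → S.lt i x y) ∧ (¬ P i → S.lt i y x)

lemma _root_.PermStruct.SignedLt.trans {P : Fin n → Prop} {x y z : Γ} (h : S.SignedLt P x y)
    (h' : S.SignedLt P y z) : S.SignedLt P x z :=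
  fun i => ⟨fun hi => ((h i).1 hi).trans ((h' i).1 hi), fun hi => ((h' i).2 hi).trans ((h i).2 hi)⟩

lemma _root_.PermStruct.IsAuto.signedLt_iff {P : Fin n → Prop} {σ : Γ ≃ Γ} (h : S.IsAuto σ)
    {x y : Γ} : S.SignedLt P (σ x) (σ y) ↔ S.SignedLt P x y := by
  simp only [SignedLt, h.lt_iff]

lemma _root_.PermStruct.SignedLt.samePat {P : Fin n → Prop} {x y z w : Γ} (h : S.SignedLt P x y)
    (h' : S.SignedLt P y z) (hw : S.SamePat w x z) : S.SamePat w y z := fun i => by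
  by_cases hi : P i
  · have h1 := ((h i).1 hi).le
    have h2 := ((h' i).1 hi).le
    exact ⟨⟨fun h3 => S.trans i _ _ _ h3 h2, fun h3 => S.trans i _ _ _ ((hw i).1.2 h3) h1⟩,
      ⟨fun h3 => (hw i).2.1 (S.trans i _ _ _ h1 h3), fun h3 => S.trans i _ _ _ h2 h3⟩⟩
  · have h1 := ((h i).2 hi).le
    have h2 := ((h' i).2 hi).le
    exact ⟨⟨fun h3 => (hw i).1.1 (S.trans i _ _ _ h3 h1), fun h3 => S.trans i _ _ _ h3 h2⟩,
      ⟨fun h3 => S.trans i _ _ _ h2 h3, fun h3 => S.trans i _ _ _ h1 ((hw i).2.2 h3)⟩⟩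

lemma _root_.PermStruct.SignedLt.allLt {P : Fin n → Prop} {x y z w : Γ} (h : S.SignedLt P x y)
    (h' : S.SignedLt P y z) (hx : S.AllLt w x) (hz : S.AllLt w z) : S.AllLt w y := fun i => by
  by_cases hi : P i
  · exact (hx i).trans ((h i).1 hi)
  · exact (hz i).trans ((h' i).2 hi)

/-- If above or below any two points of a chain in `T` there is a further point of `T` in the
direction `P`, still inside the chain, then `T` contains an increasing pair lying between two
points in direction `P`. -/
lemma _root_.PermStruct.exists_pair_between {T : Γ → Prop} {P : Fin n → Prop}
    (hT : ∀ α f₁ f₂ β, T α → T f₁ → T f₂ → T β → S.AllLt α f₁ → S.AllLt f₁ f₂ → S.AllLt f₂ β →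
      ∃ b, T b ∧ S.AllLt α b ∧ S.AllLt b β ∧ S.SignedLt P f₁ b ∧ S.SignedLt P f₂ b)
    (g : ℕ → Γ) (hgT : ∀ j, T (g j)) (hg : ∀ j k, j < k → S.AllLt (g j) (g k)) :
    ∃ f b₁ b₂ b₃, T f ∧ T b₁ ∧ T b₂ ∧ T b₃ ∧ S.AllLt b₁ b₂ ∧ S.SignedLt P f b₁ ∧
      S.SignedLt P f b₂ ∧ S.SignedLt P b₁ b₃ ∧ S.SignedLt P b₂ b₃ := by
  obtain ⟨b₂, hb₂, h1, h2, h3, h4⟩ := hT (g 1) (g 2) (g 3) (g 4) (hgT _) (hgT _) (hgT _) (hgT _)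
    (hg _ _ (by simp)) (hg _ _ (by simp)) (hg _ _ (by simp))
  obtain ⟨b₁, hb₁, h1', h2', h3', h4'⟩ := hT (g 0) (g 1) (g 2) (g 3) (hgT _) (hgT _) (hgT _) (hgT _)
    (hg _ _ (by simp)) (hg _ _ (by simp)) (hg _ _ (by simp))
  have hlt : S.AllLt b₁ b₂ := fun i => by
    by_cases hi : P i
    · exact (h2' i).trans ((h4 i).1 hi)
    · exact ((h3' i).2 hi).trans (h1 i)
  obtain ⟨b₃, hb₃, -, -, h5, h6⟩ := hT (g 0) b₁ b₂ (g 4) (hgT _) hb₁ hb₂ (hgT _) h1' hlt h2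
  exact ⟨g 2, b₁, b₂, b₃, hgT _, hb₁, hb₂, hb₃, hlt, h4', h3, h5, h6⟩

/-- The points of the class of `a` with the same type as `a` over `A`. -/
def _root_.PermStruct.SameTypeInClass (S : PermStruct n Γ) (E : Γ → Γ → Prop) (A : Set Γ)
    (a x : Γ) : Prop := E a x ∧ S.TypeOver A a x

lemma sameTypeInClass_map (H : S.HomogeneousEquiv E) {A : Set Γ} {a x y : Γ} {φ : Γ ≃ Γ}
    (hφ : S.IsAuto φ) (hA : ∀ s ∈ A, φ s = s) (hx : S.SameTypeInClass E A a x)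
    (hφx : S.SameTypeInClass E A a (φ x)) (hy : S.SameTypeInClass E A a y) :
    S.SameTypeInClass E A a (φ y) :=
  ⟨H.equiv.trans hφx.1 ((H.map_iff hφ).2 (H.equiv.trans (H.equiv.symm hx.1) hy.1)),
    hy.2.trans (hφ.typeOver_apply hA y)⟩

/-- An increasing chain `d' ≪ d ≪ g'` of points of the same type, together with `e` and the
increasing sequence `x`, both between `d` and `g'`, cannot have `d'` and `e` separated by the class
of a good point `w` that does not distinguish `d'` from `d`. -/
lemma conj_of_good (H : S.HomogeneousEquiv E) {A : Set Γ} (hA : A.Finite) {a d' d e g' w : Γ}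
    (hAa : ∀ s ∈ A, E a s) {K : ℕ}
    (hK : ∀ (w : Γ) (x : ℕ → Γ), ∃ j k, j < k ∧ k ≤ K ∧ S.SamePat w (x j) (x k))
    {x : ℕ → Γ} (hd'T : S.SameTypeInClass E A a d') (hdT : S.SameTypeInClass E A a d)
    (heT : S.SameTypeInClass E A a e) (hg'T : S.SameTypeInClass E A a g')
    (hxT : ∀ j, S.SameTypeInClass E A a (x j))
    (hd'd : S.AllLt d' d) (hde : S.AllLt d e) (heg' : S.AllLt e g')
    (hdx : ∀ j, S.AllLt d (x j)) (hx : ∀ j k, j < k → S.AllLt (x j) (x k))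
    (hxg' : ∀ j ≤ K, S.AllLt (x j) g') (haw : ¬ E a w)
    (hgood : S.Good E (insert e (insert d' (insert d (insert g' A)))) w)
    (hw : S.SamePat w d' d) : S.Conj E A w d' e := by
  by_contra hno
  set B₀ : Set Γ := insert d' (insert d (insert g' A))
  have hd'B : d' ∈ B₀ := .inl rfl
  have hdB : d ∈ B₀ := .inr (.inl rfl)
  have hg'B : g' ∈ B₀ := .inr (.inr (.inl rfl))
  have hAB : A ⊆ B₀ := fun s hs => .inr (.inr (.inr hs))
  have hB₀fin : B₀.Finite := ((hA.insert _).insert _).insert _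
  have hy : ∀ j, ∃ y, j ≤ K → S.TypeOver B₀ w y ∧
      ∀ i, (S.le i e w ↔ S.le i (x j) y) ∧ (S.le i w e ↔ S.le i y (x j)) := by
    intro j
    by_cases hj : j ≤ K
    · have h1 := hd'd.trans hde
      have h2 := hde.trans heg'
      have h3 := hd'd.trans h2
      have h4 := hd'd.trans (hdx j)
      have h5 := hdx j
      have h6 := hxg' j hj
      obtain ⟨κ, hκ, hκA, hκx⟩ := H.hom.ext_chain H.pos hA ![d', d, e, g'] ![d', d, x j, g']
        (by simpa [Fin.forall_fin_succ, TypeOver.refl] using heT.2.symm.trans (hxT j).2)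
        (by simp [Fin.forall_fin_succ, *]) (by simp [Fin.forall_fin_succ, *])
      have hκe : κ e = x j := hκx 2
      have hκB : ∀ s ∈ B₀, κ s = s := by
        rintro s (rfl | rfl | rfl | hs)
        exacts [hκx 0, hκx 1, hκx 3, hκA s hs]
      refine ⟨κ w, fun _ => ⟨hκ.typeOver_apply hκB w, fun i => ?_⟩⟩
      rw [← hκe]
      exact ⟨hκ i e w, hκ i w e⟩
    · exact ⟨w, fun h => (hj h).elim⟩
  choose y hy using hy
  have hBa : ∀ s ∈ insert e B₀, E d' s := by
    rintro s (rfl | rfl | rfl | rfl | hs)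
    exacts [H.equiv.trans (H.equiv.symm hd'T.1) heT.1, H.equiv.refl _,
      H.equiv.trans (H.equiv.symm hd'T.1) hdT.1, H.equiv.trans (H.equiv.symm hd'T.1) hg'T.1,
      H.equiv.trans (H.equiv.symm hd'T.1) (hAa s hs)]
  have hd'w : ¬ E d' w := fun h => haw (H.equiv.trans hd'T.1 h)
  obtain ⟨θ, -, -, hθ, hθB, -, -, -, -, hθe, -⟩ := H.exists_nest (Y := y '' Set.Iic K)
    (Set.subset_insert e B₀) (hB₀fin.insert e) ((Set.finite_Iic K).image y) hd'B hg'B hBa hd'w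
    hgood (by
      rintro _ ⟨j, hj, rfl⟩
      exact (hy j hj).1)
  set b := θ e
  have hbT : S.SameTypeInClass E A a b := H.sameTypeInClass_map hθ (fun s hs => hθB s (hAB hs))
    hdT ((hθB d hdB).symm ▸ hdT) heT
  have hdb : S.AllLt d b := by
    rw [← hθB d hdB]
    exact (hθ.allLt_iff _ _).2 hde
  have hbg' : S.AllLt b g' := by
    rw [← hθB g' hg'B]
    exact (hθ.allLt_iff _ _).2 heg'
  have hby : ∀ j ≤ K, ∀ i, (S.le i b (y j) ↔ S.le i e w) ∧ (S.le i (y j) b ↔ S.le i w e) :=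
    fun j hj => hθe _ ⟨j, hj, rfl⟩ e (.inl rfl)
  obtain ⟨l, m, hlm, hmK, hpat⟩ := hK b x
  have hbl : b ≠ x l := by
    rintro h
    rw [h] at hpat
    exact hx l m hlm ⟨0, H.pos⟩ ((hpat _).2.1 (S.le_self _ _))
  let P : Fin n → Prop := fun i => S.lt i (x l) b
  have hPl : S.SignedLt P (x l) b := fun i =>
    ⟨id, fun h => (lt_or_lt_of_ne (S := S) i hbl).resolve_right h⟩
  have hPm : S.SignedLt P (x m) b := fun i =>
    ⟨fun h => (hpat.lt_right i).1 h, fun h => (hpat.lt_left i).1 ((hPl i).2 h)⟩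
  obtain ⟨f, b₁, b₂, b₃, hf, hb₁, hb₂, hb₃, hlt, h1, h2, h3, h4⟩ :=
    exists_pair_between (T := S.SameTypeInClass E A a) (P := P) (S := S) (by
      intro α f₁ f₂ β hα hf₁ hf₂ hβ h1 h2 h3
      have h4 := hdx l
      have h5 := hx l m hlm
      have h6 := hxg' m hmK
      have h7 := h4.trans h5
      have h8 := h7.trans h6
      have h9 := h5.trans h6
      have h1' := h1.trans h2
      have h2' := h1'.trans h3
      have h3' := h2.trans h3
      obtain ⟨φ, hφ, hφA, hφx⟩ := H.hom.ext_chain H.pos hA ![d, x l, x m, g'] ![α, f₁, f₂, β]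
        (by simpa [Fin.forall_fin_succ] using ⟨hdT.2.symm.trans hα.2, (hxT l).2.symm.trans hf₁.2,
          (hxT m).2.symm.trans hf₂.2, hg'T.2.symm.trans hβ.2⟩)
        (by simp [Fin.forall_fin_succ, *]) (by simp [Fin.forall_fin_succ, *])
      have e0 : φ d = α := hφx 0
      have e1 : φ (x l) = f₁ := hφx 1
      have e2 : φ (x m) = f₂ := hφx 2
      have e3 : φ g' = β := hφx 3
      subst e0 e1 e2 e3
      exact ⟨φ b, H.sameTypeInClass_map hφ hφA hdT hα hbT, (hφ.allLt_iff _ _).2 hdb,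
        (hφ.allLt_iff _ _).2 hbg', hφ.signedLt_iff.2 hPl, hφ.signedLt_iff.2 hPm⟩) x hxT hx
  obtain ⟨ψ, hψ, hψA, hψx⟩ := H.hom.ext_over H.pos hA ![f, b₃] ![x l, b]
    (by simpa [Fin.forall_fin_succ] using ⟨hf.2.symm.trans (hxT l).2, hb₃.2.symm.trans hbT.2⟩)
    (by
      have hfb := h1.trans h3
      intro i
      by_cases hi : P i
      · have p := (hfb i).1 hi
        have q := (hPl i).1 hi
        simpa [Fin.forall_fin_succ, le_self, p.le, q.le] using iff_of_false p q
      · have p := (hfb i).2 hi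
        have q := (hPl i).2 hi
        simpa [Fin.forall_fin_succ, le_self, p.le, q.le] using iff_of_false p q)
  have hψf : ψ f = x l := hψx 0
  have hψb : ψ b₃ = b := hψx 1
  have hψT : ∀ z, S.SameTypeInClass E A a z → S.SameTypeInClass E A a (ψ z) := fun z =>
    H.sameTypeInClass_map hψ hψA hf (hψf ▸ hxT l)
  have hl : l ≤ K := hlm.le.trans hmK
  have hyl := hy l hl
  have hsl : S.SamePat (y l) (x l) b := fun i =>
    ⟨(hyl.2 i).2.symm.trans ((hby l hl i).2).symm, (hyl.2 i).1.symm.trans ((hby l hl i).1).symm⟩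
  have key : ∀ z, S.SignedLt P f z → S.SignedLt P z b₃ →
      S.SamePat (y l) (ψ z) b ∧ S.AllLt d (ψ z) := by
    intro z hz hz'
    have q1 : S.SignedLt P (x l) (ψ z) := hψf ▸ hψ.signedLt_iff.2 hz
    have q2 : S.SignedLt P (ψ z) b := hψb ▸ hψ.signedLt_iff.2 hz'
    exact ⟨q1.samePat q2 hsl, q1.allLt q2 (hdx l) hdb⟩
  obtain ⟨hp1, hd1⟩ := key b₁ h1 h3
  obtain ⟨hp2, hd2⟩ := key b₂ h2 h4
  have hT1 := hψT _ hb₁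
  have hT2 := hψT _ hb₂
  have hpe : ∀ i, (S.le i e w ↔ S.le i (ψ b₂) (y l)) ∧ (S.le i w e ↔ S.le i (y l) (ψ b₂)) :=
    fun i => ⟨(hby l hl i).1.symm.trans (hp2 i).2.symm, (hby l hl i).2.symm.trans (hp2 i).1.symm⟩
  have hd'e := hd'd.trans hde
  have hd'e2 := hd'd.trans hd2
  obtain ⟨χ, hχ, hχA, hχx⟩ := H.hom.ext_over H.pos hA ![d', e, w] ![d', ψ b₂, y l]
    (by simpa [Fin.forall_fin_succ, TypeOver.refl] using
      ⟨heT.2.symm.trans hT2.2, hyl.1.mono hAB⟩)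
    (by
      intro i
      have p1 := hd'e i
      have p2 := hd'e2 i
      have p3 := hyl.1 d' hd'B i
      have p4 := hpe i
      simp [Fin.forall_fin_succ, le_self, p1.le, p2.le, p3, p4, iff_of_false p1 p2])
  have hχd : χ d' = d' := hχx 0
  have hχe : χ e = ψ b₂ := hχx 1
  have hχw : χ w = y l := hχx 2
  have hd'E : ∀ z, S.SameTypeInClass E A a z → E d' z := fun z hz =>
    H.equiv.trans (H.equiv.symm hd'T.1) hz.1
  have hgood' : S.Good E (insert d' (insert (ψ b₂) A)) (y l) := by
    have := H.good_map hχ (hgood.mono (B' := insert d' (insert e A)) (by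
      rintro s (rfl | rfl | hs)
      exacts [.inr hd'B, .inl rfl, .inr (hAB hs)]))
    rwa [Set.image_insert_eq, Set.image_insert_eq, hχd, hχe, hχw,
      Set.image_congr (g := id) hχA, Set.image_id] at this
  have hw' : S.SamePat (y l) d' d := fun i => by
    have p1 := hyl.1 d' hd'B i
    have p2 := hyl.1 d hdB i
    have p3 := hw i
    exact ⟨p1.2.symm.trans (p3.1.trans p2.2), p1.1.symm.trans (p3.2.trans p2.1)⟩
  apply hno
  rw [← H.conj_map_iff hχ hχA, hχd, hχe, hχw]
  refine H.conj_of_chain hA (fun s hs => H.equiv.trans (H.equiv.symm hd'T.1) (hAa s hs))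
    (hd'E _ hT2) hd'd hd1 ((hψ.allLt_iff _ _).2 hlt) (hd'T.2.symm.trans hdT.2)
    (hd'T.2.symm.trans hT1.2) (hd'T.2.symm.trans hT2.2) (fun h => hd'w ?_) hgood' hw'
    (hp1.trans hp2.symm)
  rw [← hχd, ← hχw, H.map_iff hχ] at h
  exact h

lemma conj_of_allLt (H : S.HomogeneousEquiv E) {A : Set Γ} (hA : A.Finite) {a b c : Γ}
    (hAa : ∀ s ∈ A, E a s) (hab : S.TypeOver A a b) (hE : E a b) (hlt : S.AllLt a b)
    (hac : ¬ E a c) : S.Conj E A c a b := by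
  obtain ⟨K, hK⟩ := exists_samePat n
  by_contra hno
  obtain ⟨κ, hκ, hκA, hκa⟩ := H.hom.ext_one H.pos hA hab
  have hpow : ∀ j : ℕ, S.IsAuto ((κ : Equiv.Perm Γ) ^ j) ∧
      ∀ s ∈ A, ((κ : Equiv.Perm Γ) ^ j) s = s := by
    intro j
    induction j with
    | zero => exact ⟨isAuto_refl, fun _ _ => rfl⟩
    | succ j ih =>
      rw [pow_succ]
      exact ⟨hκ.trans ih.1, fun s hs => by simp [hκA s hs, ih.2 s hs]⟩
  set g : ℕ → Γ := fun j => ((κ : Equiv.Perm Γ) ^ j) a with hg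
  have hgsucc : ∀ j, g (j + 1) = ((κ : Equiv.Perm Γ) ^ j) b := fun j => by
    simp [hg, pow_succ, hκa]
  have hsucc : ∀ j, S.AllLt (g j) (g (j + 1)) ∧ E (g j) (g (j + 1)) := fun j => by
    rw [hgsucc]
    exact ⟨((hpow j).1.allLt_iff _ _).2 hlt, (H.map_iff (hpow j).1).2 hE⟩
  have hglt : ∀ j k, j < k → S.AllLt (g j) (g k) := fun j k hjk => by
    have : IsTrans Γ S.AllLt := ⟨fun _ _ _ => AllLt.trans⟩
    exact Nat.rel_of_forall_rel_succ_of_lt S.AllLt (fun j => (hsucc j).1) hjk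
  have hgT : ∀ j, S.SameTypeInClass E A a (g j) := by
    intro j
    refine ⟨?_, (hpow j).1.typeOver_apply (hpow j).2 a⟩
    induction j with
    | zero => exact H.equiv.refl a
    | succ j ih => exact H.equiv.trans ih (hsucc j).2
  have hφ := hpow (K + 1)
  set φ : Γ ≃ Γ := (κ : Equiv.Perm Γ) ^ (K + 1)
  have hφa : φ a = g (K + 1) := rfl
  obtain ⟨τ, hτ, hτa⟩ := S.exists_auto_apply H.pos H.hom a (φ c)
  obtain ⟨w, hcw, hw⟩ := H.exists_good (c := φ c) (c' := τ b)
    (hτa ▸ (H.map_iff hτ).2 hE) (fun h => (hlt ⟨0, H.pos⟩).ne (τ.injective (hτa.trans h)))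
    (hA.union ((Set.finite_Iic (2 * K + 4)).image g))
  have haw : ¬ E a w := fun h => hac <| by
    rw [← H.map_iff hφ.1]
    exact H.equiv.trans (H.equiv.symm (hgT (K + 1)).1)
      (H.equiv.trans h (H.equiv.symm hcw))
  have hno' : ¬ S.Conj E A w (g (K + 1)) (g (K + 1 + 1)) := fun h => hno <| by
    have := H.conj_of_rel h (H.equiv.symm hcw)
    rw [hgsucc (K + 1), ← hφa] at this
    exact (H.conj_map_iff hφ.1 hφ.2).1 this
  obtain ⟨j, k, hjk, hkK, hpat⟩ := hK S w g
  have main : ∀ l, K < l → l ≤ K + 2 → S.Conj E A w (g j) (g l) := by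
    intro l hl hl'
    refine H.conj_of_good hA (d := g k) (g' := g (2 * K + 4)) hAa (hK S)
      (x := fun i => g (K + 3 + i)) (hgT _) (hgT _) (hgT _) (hgT _) (fun _ => hgT _)
      (hglt _ _ hjk) (hglt _ _ (by omega)) (hglt _ _ (by omega))
      (fun i => hglt _ _ (by omega)) (fun i i' _ => hglt _ _ (by omega))
      (fun i _ => hglt _ _ (by omega)) haw (hw.mono ?_) hpat
    have hgm : ∀ i ≤ 2 * K + 4, g i ∈ A ∪ g '' Set.Iic (2 * K + 4) := fun i hi =>
      .inr ⟨i, hi, rfl⟩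
    rintro s (rfl | rfl | rfl | rfl | hs)
    exacts [hgm _ (by omega), hgm _ (by omega), hgm _ (by omega), hgm _ le_rfl, .inl hs]
  exact hno' (H.conj_trans (H.conj_symm (main (K + 1) (by omega) (by omega)))
    (main (K + 1 + 1) (by omega) (by omega)))

end HomogeneousEquiv

/-- The structure obtained by reversing the orders outside `q`. -/
def flip (S : PermStruct n Γ) (q : Fin n → Prop) : PermStruct n Γ where
  le i x y := (q i → S.le i x y) ∧ (¬ q i → S.le i y x)
  total i x y := by
    have := S.total i x y
    tauto
  antisymm i x y h h' := by
    by_cases hi : q i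
    · exact S.antisymm i x y (h.1 hi) (h'.1 hi)
    · exact S.antisymm i x y (h'.2 hi) (h.2 hi)
  trans i x y z h h' :=
    ⟨fun hi => S.trans i _ _ _ (h.1 hi) (h'.1 hi), fun hi => S.trans i _ _ _ (h'.2 hi) (h.2 hi)⟩

lemma flip_isAuto_iff (q : Fin n → Prop) {σ : Γ ≃ Γ} : (S.flip q).IsAuto σ ↔ S.IsAuto σ := by
  refine forall_congr' fun i => ?_
  simp only [flip]
  by_cases hi : q i <;> simp only [hi, true_imp_iff, not_true, not_false_iff, false_imp_iff,
    and_true, true_and]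
  exact forall_comm

lemma Homogeneous.flip (hh : S.Homogeneous) (q : Fin n → Prop) : (S.flip q).Homogeneous := by
  intro A f hf h
  obtain ⟨σ, hσ, hσA⟩ := hh A f hf fun i x hx y hy => by
    by_cases hi : q i
    · simpa [PermStruct.flip, hi] using h i x hx y hy
    · simpa [PermStruct.flip, hi] using h i y hy x hx
  exact ⟨σ, (flip_isAuto_iff q).2 hσ, hσA⟩

namespace HomogeneousEquiv

lemma flip (H : S.HomogeneousEquiv E) (q : Fin n → Prop) : (S.flip q).HomogeneousEquiv E where
  pos := H.pos
  hom := H.hom.flip q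
  defn σ hσ := H.defn σ ((flip_isAuto_iff q).1 hσ)
  equiv := H.equiv

/-- Two points of a class with the same type over a finite subset `A` of the class are conjugate
over `A` by an automorphism stabilizing any given other class. -/
lemma conj_of_typeOver (H : S.HomogeneousEquiv E) {A : Set Γ} (hA : A.Finite) {a b c : Γ}
    (hAa : ∀ s ∈ A, E a s) (hab : S.TypeOver A a b) (hE : E a b) (hac : ¬ E a c) :
    S.Conj E A c a b := by
  by_cases hne : a = b
  · subst hne
    exact ⟨Equiv.refl Γ, isAuto_refl, fun _ _ => rfl, rfl, H.equiv.refl c⟩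
  let q : Fin n → Prop := fun i => S.lt i a b
  obtain ⟨h, hh, hA', hhab, hc⟩ := (H.flip q).conj_of_allLt hA hAa (b := b) (c := c)
    (fun s hs i => by
      have := hab s hs i
      simp only [PermStruct.flip]
      tauto) hE
    (fun i h => by
      by_cases hi : q i
      · exact hi (h.1 hi)
      · exact hi (lt_of_le_of_ne (h.2 hi) hne)) hac
  exact ⟨h, (flip_isAuto_iff q).1 hh, hA', hhab, hc⟩

lemma extends_stabilizing (H : S.HomogeneousEquiv E) {c₁ c₂ : Γ} (hc : ¬ E c₁ c₂) (f : Γ → Γ)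
    (A : Finset Γ) (hA : ∀ a ∈ A, E c₁ a) (hf : ∀ a ∈ A, E c₁ (f a))
    (hpres : ∀ i, ∀ x ∈ A, ∀ y ∈ A, (S.le i x y ↔ S.le i (f x) (f y))) :
    ∃ σ : Γ ≃ Γ, S.IsAuto σ ∧ (∀ a ∈ A, σ a = f a) ∧ E c₁ (σ c₁) ∧ E c₂ (σ c₂) := by
  classical
  induction A using Finset.induction_on with
  | empty => exact ⟨Equiv.refl Γ, isAuto_refl, by simp, H.equiv.refl _, H.equiv.refl _⟩
  | insert a A _ ih =>
    have ha := Finset.mem_insert_self a A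
    have hsub : ∀ s ∈ A, s ∈ insert a A := fun s => Finset.mem_insert_of_mem
    obtain ⟨g, hg, hgA, hg₁, hg₂⟩ := ih (fun s hs => hA s (hsub s hs))
      (fun s hs => hf s (hsub s hs)) fun i x hx y hy => hpres i x (hsub x hx) y (hsub y hy)
    have hac := hA a ha
    have hb : E c₁ (g.symm (f a)) := by
      rw [← H.map_iff hg]
      simpa using H.equiv.trans (H.equiv.symm hg₁) (hf a ha)
    obtain ⟨h, hh, hhA, hha, hhc⟩ := H.conj_of_typeOver A.finite_toSet (a := a)
      (b := g.symm (f a)) (c := c₂)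
      (fun s hs => H.equiv.trans (H.equiv.symm hac) (hA s (hsub s hs)))
      (fun s hs i => by
        rw [hg i s (g.symm (f a)), hg i (g.symm (f a)) s, hgA s hs]
        simpa using ⟨hpres i s (hsub s hs) a ha, hpres i a ha s (hsub s hs)⟩)
      (H.equiv.trans (H.equiv.symm hac) hb)
      (fun h => hc (H.equiv.trans hac h))
    refine ⟨h.trans g, hh.trans hg, fun s hs => ?_, ?_, ?_⟩
    · rcases Finset.mem_insert.1 hs with rfl | hs
      · simp [hha]
      · simp [hhA s hs, hgA s hs]
    · refine H.equiv.trans (hf a ha) (H.equiv.symm ?_)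
      have : f a = h.trans g a := by simp [hha]
      rw [this, H.map_iff (hh.trans hg)]
      exact hac
    · exact H.equiv.trans hg₂ ((H.map_iff hg).2 hhc)

end HomogeneousEquiv

lemma Definable.stabilizes {S : PermStruct n Γ} (hd : S.Definable E) (he : Equivalence E)
    {σ : Γ ≃ Γ} (hσ : S.IsAuto σ) {c : Γ} (hc : E c (σ c)) (x : Γ) : E c x ↔ E c (σ x) :=
  (hd σ hσ c x).trans ⟨fun h => he.trans hc h, fun h => he.trans (he.symm hc) h⟩

/-- In dimension zero, a `∅`-definable equivalence relation with inequivalent points has trivial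
classes. -/
lemma Homogeneous.eq_of_rel_of_eq_zero (hh : S.Homogeneous) (hd : S.Definable E) (hn : n = 0)
    (he : Equivalence E) {c x y : Γ} (hc : ¬ E x c) (hxy : E x y) : x = y := by
  classical
  subst hn
  by_contra hne
  have hσ : S.IsAuto (Equiv.swap y c) := fun i => i.elim0
  have hxc : x ≠ c := by
    rintro rfl
    exact hc (he.refl _)
  have := (hd _ hσ x y).1 hxy
  rw [Equiv.swap_apply_of_ne_of_ne hne hxc, Equiv.swap_apply_left] at this
  exact hc this

end PermStruct

/-- In a homogeneous `n`-dimensional permutation structure, an `E`-class `C₁` remains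
homogeneous after naming another `E`-class `C₂`: every isomorphism between finite substructures
contained in `C₁` extends to an automorphism of `Γ` fixing `C₁` and `C₂` setwise. -/
theorem class_homogeneous_after_naming_class
    {n : ℕ} {Γ : Type*} [Countable Γ] [Infinite Γ] (S : PermStruct n Γ)
    (hhom : S.Homogeneous)
    (E : Γ → Γ → Prop) (hEdef : S.Definable E) (hEequiv : Equivalence E)
    (c₁ c₂ : Γ)
    (A : Finset Γ) (hA : ∀ a ∈ A, E c₁ a)
    (f : Γ → Γ) (hinj : Set.InjOn f A)
    (hfC₁ : ∀ a ∈ A, E c₁ (f a))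
    (hpres : ∀ i, ∀ x ∈ A, ∀ y ∈ A, (S.le i x y ↔ S.le i (f x) (f y))) :
    ∃ σ : Γ ≃ Γ, S.IsAuto σ ∧ (∀ a ∈ A, σ a = f a) ∧
      (∀ x, E c₁ x ↔ E c₁ (σ x)) ∧ (∀ x, E c₂ x ↔ E c₂ (σ x)) := by
  by_cases hc : E c₁ c₂
  · suffices ∃ σ : Γ ≃ Γ, S.IsAuto σ ∧ (∀ a ∈ A, σ a = f a) ∧ E c₁ (σ c₁) by
      obtain ⟨σ, hσ, hσA, h₁⟩ := this
      have h₂ : E c₂ (σ c₂) := hEequiv.trans (hEequiv.symm hc)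
        (hEequiv.trans h₁ ((hEdef σ hσ _ _).1 hc))
      exact ⟨σ, hσ, hσA, hEdef.stabilizes hEequiv hσ h₁, hEdef.stabilizes hEequiv hσ h₂⟩
    rcases A.eq_empty_or_nonempty with rfl | ⟨a, ha⟩
    · exact ⟨Equiv.refl Γ, PermStruct.isAuto_refl, by simp, hEequiv.refl _⟩
    · obtain ⟨σ, hσ, hσA⟩ := hhom A f hinj hpres
      refine ⟨σ, hσ, hσA, hEequiv.trans (hfC₁ a ha) (hEequiv.symm ?_)⟩
      rw [← hσA a ha]
      exact (hEdef σ hσ _ _).1 (hA a ha)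
  · rcases n.eq_zero_or_pos with hn | hn
    · refine ⟨Equiv.refl Γ, PermStruct.isAuto_refl, fun a ha => ?_, fun _ => Iff.rfl,
        fun _ => Iff.rfl⟩
      have h1 := hhom.eq_of_rel_of_eq_zero hEdef hn hEequiv hc (hA a ha)
      have h2 := hhom.eq_of_rel_of_eq_zero hEdef hn hEequiv hc (hfC₁ a ha)
      exact h1.symm.trans h2
    · have H : S.HomogeneousEquiv E := ⟨hn, hhom, hEdef, hEequiv⟩
      obtain ⟨σ, hσ, hσA, h₁, h₂⟩ := H.extends_stabilizing hc f A hA hfC₁ hpres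
      exact ⟨σ, hσ, hσA, hEdef.stabilizes hEequiv hσ h₁, hEdef.stabilizes hEequiv hσ h₂⟩
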